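/- Let q > 1, and suppose c, s : ℝ → ℝ are differentiable functions satisfying s'(w) = |c(w)|^{q-1}·sgn(c(w)), c'(w) = -|s(w)|^{q-1}·sgn(s(w)), with s(0) = 0 and c(0) = 1. If w₀ ≥ 0 is such that s(w) ≥ 0 for all w ∈ [0, w₀], then s(w₀) - w₀·c(w₀) ≥ 0. -/

import Mathlib

theorem abs_rpow_mul_sign_of_nonneg {p x : ℝ} (hp : p ≠ 0) (hx : 0 ≤ x) :
    |x| ^ p * Real.sign x = x ^ p := by
  rcases hx.eq_or_lt with rfl | hx
  · simp [Real.zero_rpow hp]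
  · rw [abs_of_pos hx, Real.sign_of_pos hx, mul_one]

theorem rpow_sub_one_mul_self {q x : ℝ} (hq : 1 < q) (hx : 0 ≤ x) :
    x ^ (q - 1) * x = x ^ q := by
  rcases hx.eq_or_lt with rfl | hx
  · simp [Real.zero_rpow (by linarith : q ≠ 0)]
  · rw [Real.rpow_sub_one hx.ne', div_mul_cancel₀ _ hx.ne']

theorem sin_sub_mul_cos_nonneg (q : ℝ) (hq : 1 < q) (c s : ℝ → ℝ)
    (hs : ∀ w : ℝ, HasDerivAt s (|c w| ^ (q - 1) * Real.sign (c w)) w)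
    (hc : ∀ w : ℝ, HasDerivAt c (-(|s w| ^ (q - 1) * Real.sign (s w))) w)
    (hs0 : s 0 = 0) (hc0 : c 0 = 1)
    (w₀ : ℝ) (hw₀ : 0 ≤ w₀) (hnn : ∀ w ∈ Set.Icc 0 w₀, 0 ≤ s w) :
    0 ≤ s w₀ - w₀ * c w₀ := by
  have hmem₀ : (0 : ℝ) ∈ Set.Icc 0 w₀ := ⟨le_rfl, hw₀⟩
  have hmem : w₀ ∈ Set.Icc 0 w₀ := ⟨hw₀, le_rfl⟩
  rcases le_or_gt (c w₀) 0 with hneg | hpos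
  · nlinarith [hnn w₀ hmem]
  have hq1 : q - 1 ≠ 0 := by linarith
  have hc' : ∀ w ∈ Set.Icc 0 w₀, HasDerivAt c (-(s w ^ (q - 1))) w := fun w hw => by
    simpa only [abs_rpow_mul_sign_of_nonneg hq1 (hnn w hw)] using hc w
  have hanti : AntitoneOn c (Set.Icc 0 w₀) := by
    refine antitoneOn_of_deriv_nonpos (convex_Icc 0 w₀)
      (fun w _ => (hc w).continuousAt.continuousWithinAt)
      (fun w _ => (hc w).differentiableAt.differentiableWithinAt) fun w hw => ?_
    have hw' := interior_subset hw
    rw [(hc' w hw').deriv]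
    exact neg_nonpos.2 (Real.rpow_nonneg (hnn w hw') _)
  have hcpos : ∀ w ∈ Set.Icc 0 w₀, 0 < c w := fun w hw =>
    hpos.trans_le (hanti hw hmem hw.2)
  have hs' : ∀ w ∈ Set.Icc 0 w₀, HasDerivAt s (c w ^ (q - 1)) w := fun w hw => by
    simpa only [abs_rpow_mul_sign_of_nonneg hq1 (hcpos w hw).le] using hs w
  have henergy_deriv : ∀ w ∈ Set.Icc 0 w₀,
      HasDerivAt (fun x => c x ^ q + s x ^ q) 0 w := fun w hw => by
    refine (((hc' w hw).rpow_const (p := q) (Or.inr hq.le)).add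
      ((hs' w hw).rpow_const (p := q) (Or.inr hq.le))).congr_deriv ?_
    ring
  have henergy : ∀ w ∈ Set.Icc 0 w₀, c w ^ q + s w ^ q = 1 := fun w hw => by
    have h := constant_of_has_deriv_right_zero
      (fun x hx => (henergy_deriv x hx).continuousAt.continuousWithinAt)
      (fun x hx => (henergy_deriv x (Set.Ico_subset_Icc_self hx)).hasDerivWithinAt) w hw
    simpa [hs0, hc0, Real.zero_rpow (by linarith : q ≠ 0)] using h
  have hderiv : ∀ w ∈ Set.Icc 0 w₀,
      HasDerivAt (fun x => s x / c x - x) (1 / c w ^ 2 - 1) w := fun w hw => by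
    refine (((hs' w hw).div (hc' w hw) (hcpos w hw).ne').sub (hasDerivAt_id w)).congr_deriv ?_
    congr 2
    linear_combination henergy w hw + rpow_sub_one_mul_self hq (hcpos w hw).le +
      rpow_sub_one_mul_self hq (hnn w hw)
  have hmono : MonotoneOn (fun x => s x / c x - x) (Set.Icc 0 w₀) := by
    refine monotoneOn_of_deriv_nonneg (convex_Icc 0 w₀)
      (fun w hw => (hderiv w hw).continuousAt.continuousWithinAt)
      (fun w hw => (hderiv w (interior_subset hw)).differentiableAt.differentiableWithinAt)
      fun w hw => ?_
    have hw' := interior_subset hw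
    rw [(hderiv w hw').deriv, sub_nonneg]
    have hle : c w ≤ 1 := hc0 ▸ hanti hmem₀ hw' hw'.1
    exact one_le_one_div (pow_pos (hcpos w hw') 2) (pow_le_one₀ (hcpos w hw').le hle)
  have h : w₀ ≤ s w₀ / c w₀ := by simpa [hs0] using hmono hmem₀ hmem hw₀
  exact sub_nonneg.2 ((le_div_iff₀ hpos).1 h)
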